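/- Let n ≥ 4 and 4 ≤ k ≤ n, and set α = 2 - 2/(k-1) (so 1 < α < 2). For σ > 0 define u^σ : ℝⁿ → ℝ by u^σ(x) = (1 + x₁²)·(σ + x₂² + ⋯ + x_{k-1}²)^{α/2}. Then: (i) for every σ > 0 and every x ∈ ℝⁿ, σ_k(D²u^σ(x)) = 0 (since u^σ depends only on the first k-1 coordinates, its Hessian has rank at most k-1); and (ii) there exist r > 0 and c > 0, independent of σ, such that for all σ ∈ (0,1] and all x in the open ball B_r, σ_{k-1}(D²u^σ(x)) ≥ c. -/

import Mathlib

open scoped BigOperators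
noncomputable section

/-- `σ_k` of a matrix: the `k`-th elementary symmetric function of its eigenvalues,
equivalently the sum of all `k×k` principal minors, read off from the characteristic
polynomial. -/
def sigmaMat {n : ℕ} (k : ℕ) (A : Matrix (Fin n) (Fin n) ℝ) : ℝ :=
  (-1 : ℝ) ^ k * (Matrix.charpoly A).coeff (n - k)

/-- The Hessian matrix `D²u(x)`. -/
def hess {n : ℕ} (u : EuclideanSpace ℝ (Fin n) → ℝ) (x : EuclideanSpace ℝ (Fin n)) :
    Matrix (Fin n) (Fin n) ℝ :=
  fun i j =>
    fderiv ℝ (fun y => fderiv ℝ u y (EuclideanSpace.single j 1)) x (EuclideanSpace.single i 1)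

/-- The Pogorelov-type function `u^σ(x) = (1 + x₁²)(σ + x₂² + ⋯ + x_{k-1}²)^{α/2}`
(coordinates one-indexed). -/
def uSig (n k : ℕ) (hn : 0 < n) (α σ : ℝ) (x : EuclideanSpace ℝ (Fin n)) : ℝ :=
  (1 + (x ⟨0, hn⟩) ^ 2) *
    (σ + ∑ i ∈ Finset.univ.filter (fun i : Fin n => 1 ≤ (i : ℕ) ∧ (i : ℕ) < k - 1),
      (x i) ^ 2) ^ (α / 2)

section Calculus

theorem hasFDerivAt_add_sum_sq {ι : Type*} [Fintype ι] (T : Finset ι) (σ : ℝ) (x : EuclideanSpace ℝ ι) :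
    HasFDerivAt (fun y : EuclideanSpace ℝ ι => σ + ∑ i ∈ T, (y i) ^ 2)
      (∑ i ∈ T, (2 * x i) • EuclideanSpace.proj (𝕜 := ℝ) i) x := by
  refine HasFDerivAt.const_add σ (HasFDerivAt.fun_sum fun i _ => ?_)
  simpa using (PiLp.hasFDerivAt_apply (𝕜 := ℝ) 2 x i).pow 2

theorem sum_smul_proj_single {ι : Type*} [DecidableEq ι] (T : Finset ι) (x : EuclideanSpace ℝ ι) (j : ι) :
    (∑ i ∈ T, (2 * x i) • EuclideanSpace.proj (𝕜 := ℝ) i : StrongDual ℝ (EuclideanSpace ℝ ι))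
      (EuclideanSpace.single j 1) = if j ∈ T then 2 * x j else 0 := by
  simp [sum_apply]

theorem add_sum_sq_pos {ι : Type*} (T : Finset ι) {σ : ℝ} (hσ : 0 < σ) (x : EuclideanSpace ℝ ι) :
    0 < σ + ∑ i ∈ T, (x i) ^ 2 := by
  positivity

theorem fderiv_one_add_sq_mul_rpow {ι : Type*} [Fintype ι] [DecidableEq ι]
    (T : Finset ι) (o : ι) {σ : ℝ} (hσ : 0 < σ) (β : ℝ) (x : EuclideanSpace ℝ ι) (j : ι) :
    fderiv ℝ (fun y : EuclideanSpace ℝ ι =>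
        (1 + (y o) ^ 2) * (σ + ∑ i ∈ T, (y i) ^ 2) ^ β) x (EuclideanSpace.single j 1) =
      (if j = o then 2 else 0) * (x o * (σ + ∑ i ∈ T, (x i) ^ 2) ^ β) +
      (if j ∈ T then 2 * β else 0) *
        ((1 + (x o) ^ 2) * (x j * (σ + ∑ i ∈ T, (x i) ^ 2) ^ (β - 1))) := by
  have h1 := ((PiLp.hasFDerivAt_apply (𝕜 := ℝ) 2 x o).pow 2).const_add 1
  have h2 := (hasFDerivAt_add_sum_sq T σ x).rpow_const (p := β)
    (Or.inl (add_sum_sq_pos T hσ x).ne')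
  rw [(h1.fun_mul h2).fderiv]
  simp only [add_apply, smul_apply, sum_smul_proj_single]
  by_cases ho : j = o
  · subst ho
    by_cases hT : j ∈ T <;> simp [hT] <;> ring
  · by_cases hT : j ∈ T <;> simp [hT, ho, Ne.symm ho]
    ring

theorem hessian_one_add_sq_mul_rpow {ι : Type*} [Fintype ι] [DecidableEq ι]
    (T : Finset ι) (o : ι) {σ : ℝ} (hσ : 0 < σ) (β : ℝ) (x : EuclideanSpace ℝ ι) (i j : ι) :
    fderiv ℝ (fun z => fderiv ℝ (fun y : EuclideanSpace ℝ ι =>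
        (1 + (y o) ^ 2) * (σ + ∑ i ∈ T, (y i) ^ 2) ^ β) z (EuclideanSpace.single j 1)) x
        (EuclideanSpace.single i 1) =
      (if i = j then if j = o then 2 * (σ + ∑ i ∈ T, (x i) ^ 2) ^ β else 0 else 0) +
      (if i = j then if j ∈ T then
        2 * β * (1 + (x o) ^ 2) * (σ + ∑ i ∈ T, (x i) ^ 2) ^ (β - 1) else 0 else 0) +
      4 * β * x o * (σ + ∑ i ∈ T, (x i) ^ 2) ^ (β - 1) *
        ((if i = o then 1 else 0) * (if j ∈ T then x j else 0) +
          (if i ∈ T then x i else 0) * (if j = o then 1 else 0)) +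
      4 * β * (β - 1) * (1 + (x o) ^ 2) * (σ + ∑ i ∈ T, (x i) ^ 2) ^ (β - 1 - 1) *
        ((if i ∈ T then x i else 0) * (if j ∈ T then x j else 0)) := by
  simp_rw [fderiv_one_add_sq_mul_rpow T o hσ β]
  have h0 := PiLp.hasFDerivAt_apply (𝕜 := ℝ) 2 x o
  have hj := PiLp.hasFDerivAt_apply (𝕜 := ℝ) 2 x j
  have h1 := (h0.pow 2).const_add 1
  have hp : ∀ p : ℝ, _ := fun p => (hasFDerivAt_add_sum_sq T σ x).rpow_const (p := p)
    (Or.inl (add_sum_sq_pos T hσ x).ne')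
  have h := ((h0.fun_mul (hp β)).const_mul (if j = o then 2 else 0)).fun_add
    ((h1.fun_mul (hj.fun_mul (hp (β - 1)))).const_mul (if j ∈ T then 2 * β else 0))
  rw [HasFDerivAt.fderiv h]
  simp only [add_apply, smul_apply, sum_smul_proj_single]
  have hpr : ∀ l : ι, (PiLp.proj 2 (fun _ : ι => ℝ) l : StrongDual ℝ (EuclideanSpace ℝ ι))
      (EuclideanSpace.single i 1) = if i = l then 1 else 0 := by
    intro l
    simp [eq_comm]
  simp only [hpr, smul_eq_mul]
  by_cases hio : i = o <;> by_cases hjo : j = o <;> by_cases hij : i = j <;>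
    by_cases hiT : i ∈ T <;> by_cases hjT : j ∈ T <;>
    simp_all <;> ring

end Calculus

section LinearAlgebra

open Matrix Polynomial

theorem charpoly_eq_mul_X_pow_of_support {ι : Type*} [Fintype ι] [DecidableEq ι]
    {R : Type*} [CommRing R] (M : Matrix ι ι R) (p : ι → Prop) [DecidablePred p] (h : ∀ i, ¬ p i → ∀ j, M i j = 0) :
    M.charpoly = (M.toSquareBlockProp p).charpoly * X ^ Fintype.card {i // ¬ p i} := by
  rw [charpoly, twoBlockTriangular_det (charmatrix M) p]
  · congr 1
    · rw [charpoly]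
      congr 1
      ext1 i j
      by_cases hij : i = j
      · subst hij
        simp [toSquareBlockProp_def]
      · have : (i : ι) ≠ j := fun h => hij (Subtype.ext h)
        simp [toSquareBlockProp_def, charmatrix_apply_ne, hij, this]
    · have : (charmatrix M).toSquareBlockProp (fun i => ¬ p i) =
          diagonal fun _ => (X : R[X]) := by
        ext1 i j
        by_cases hij : i = j
        · subst hij
          simp [toSquareBlockProp_def, h i i.2]
        · have : (i : ι) ≠ j := fun h => hij (Subtype.ext h)
          simp [toSquareBlockProp_def, charmatrix_apply_ne, hij, this, h i i.2]
      rw [this, det_diagonal]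
      simp
  · intro i hi j hj
    have : i ≠ j := fun h => hi (h ▸ hj)
    simp [charmatrix_apply_ne, this, h i hi]

theorem det_diagonal_add_rank_two {ι : Type*} [Fintype ι] [DecidableEq ι]
    (o : ι) (y : ι → ℝ) (hy : y o = 0) {a μ : ℝ} (ha : a ≠ 0)
    (hμ : μ ≠ 0) (p q : ℝ) {m : ℕ} (hcard : Fintype.card ι = m + 2) :
    (of fun i j => (if i = j then if j = o then a else μ else 0) +
      p * ((if i = o then 1 else 0) * y j + y i * (if j = o then 1 else 0)) +
      q * (y i * y j)).det =
    μ ^ m * (a * (μ + q * ∑ i, y i ^ 2) - p ^ 2 * ∑ i, y i ^ 2) := by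
  let d : ι → ℝ := fun i => if i = o then a else μ
  have hd : ∀ i, d i ≠ 0 := fun i => by dsimp only [d]; split_ifs <;> assumption
  let U : Matrix ι (Fin 2) ℝ := of fun i => ![if i = o then 1 else 0, y i]
  let V : Matrix (Fin 2) ι ℝ :=
    of ![fun j => p * y j, fun j => p * (if j = o then 1 else 0) + q * y j]
  have hdet : (diagonal d).det = a * μ ^ (m + 1) := by
    rw [det_diagonal, ← Finset.mul_prod_erase _ _ (Finset.mem_univ o),
      Finset.prod_congr rfl (g := fun _ => μ)]
    · simp [d, Finset.card_erase_of_mem, hcard]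
    · intro i hi
      simp [d, Finset.ne_of_mem_erase hi]
  have hinv : (diagonal d)⁻¹ = diagonal fun i => (d i)⁻¹ := by
    refine inv_eq_right_inv ?_
    rw [diagonal_mul_diagonal, ← diagonal_one]
    congr 1
    ext i
    exact mul_inv_cancel₀ (hd i)
  have hM : (of fun i j => (if i = j then if j = o then a else μ else 0) +
      p * ((if i = o then 1 else 0) * y j + y i * (if j = o then 1 else 0)) +
      q * (y i * y j)) = diagonal d + U * V := by
    ext i j
    have hUV : (U * V) i j = U i 0 * V 0 j + U i 1 * V 1 j := by
      rw [Matrix.mul_apply, Fin.sum_univ_two]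
    rw [Matrix.add_apply, hUV]
    by_cases hij : i = j
    · subst hij
      simp only [of_apply, diagonal_apply_eq, U, V, d, if_true, cons_val_zero, cons_val_one]
      ring
    · simp only [of_apply, diagonal_apply_ne _ hij, U, V, hij, if_false, cons_val_zero,
        cons_val_one]
      ring
  rw [hM, det_add_mul _ _ (by rw [hdet]; exact (mul_ne_zero ha (pow_ne_zero _ hμ)).isUnit), hdet,
    hinv, det_fin_two]
  have key : ∀ i, y i * (d i)⁻¹ = y i * μ⁻¹ := by
    intro i
    by_cases hi : i = o
    · subst hi; simp [hy]
    · simp [d, hi]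
  have hW : ∀ r s, (1 + V * diagonal (fun i => (d i)⁻¹) * U : Matrix (Fin 2) (Fin 2) ℝ) r s =
      (1 : Matrix (Fin 2) (Fin 2) ℝ) r s + ∑ i, V r i * (d i)⁻¹ * U i s := fun r s => by
    rw [Matrix.add_apply, mul_apply]
    simp only [mul_diagonal]
  have e00 : ∑ i, V 0 i * (d i)⁻¹ * U i 0 = 0 := by
    simp [U, V, hy]
  have e01 : ∑ i, V 0 i * (d i)⁻¹ * U i 1 = p * μ⁻¹ * ∑ i, y i ^ 2 := by
    rw [Finset.mul_sum]
    refine Finset.sum_congr rfl fun i _ => ?_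
    simp only [U, V, of_apply, cons_val_zero, cons_val_one]
    rw [mul_assoc p, key]
    ring
  have e10 : ∑ i, V 1 i * (d i)⁻¹ * U i 0 = p * a⁻¹ := by
    simp [U, V, hy, d]
  have e11 : ∑ i, V 1 i * (d i)⁻¹ * U i 1 = q * μ⁻¹ * ∑ i, y i ^ 2 := by
    rw [Finset.mul_sum]
    refine Finset.sum_congr rfl fun i _ => ?_
    by_cases hi : i = o
    · subst hi; simp [U, hy]
    · simp [hi, d, U, V]
      ring
  simp only [hW, e00, e01, e10, e11, Matrix.one_apply, if_true, if_false, zero_ne_one, one_ne_zero]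
  field_simp
  ring

theorem sigmaMat_of_support {n m : ℕ} (hm : m ≤ n) (M : Matrix (Fin n) (Fin n) ℝ)
    (h : ∀ i : Fin n, ¬ (i : ℕ) < m → ∀ j, M i j = 0) :
    (∀ k, m < k → k ≤ n → sigmaMat k M = 0) ∧
      sigmaMat m M = (M.toSquareBlockProp fun i => (i : ℕ) < m).det := by
  have hc := charpoly_eq_mul_X_pow_of_support M (fun i => (i : ℕ) < m) h
  have card_lt : Fintype.card {i : Fin n // (i : ℕ) < m} = m := by
    simp [Fintype.card_subtype, Fin.card_filter_val_lt, hm]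
  have card_ge : Fintype.card {i : Fin n // ¬ (i : ℕ) < m} = n - m := by
    rw [Fintype.card_subtype_compl, card_lt, Fintype.card_fin]
  rw [card_ge] at hc
  refine ⟨fun k hk hkn => ?_, ?_⟩
  · rw [sigmaMat, hc, coeff_mul_X_pow', if_neg (by omega), mul_zero]
  · rw [sigmaMat, hc, coeff_mul_X_pow', if_pos le_rfl, Nat.sub_self,
      det_eq_sign_charpoly_coeff, card_lt]

end LinearAlgebra

theorem det_lower_bound {l : ℕ} (hl : 1 ≤ l) {β s Y t : ℝ} (hβ : β = 1 - 1 / ((l : ℝ) + 2))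
    (hs : 0 < s) (hY : 0 ≤ Y) (hYs : Y ≤ s) (ht : t ^ 2 ≤ 1 / 24) :
    (2 * β) ^ l * (2 * β / 3) ≤ (2 * β * (1 + t ^ 2) * s ^ (β - 1)) ^ l *
      (2 * s ^ β * (2 * β * (1 + t ^ 2) * s ^ (β - 1) +
        4 * β * (β - 1) * (1 + t ^ 2) * s ^ (β - 1 - 1) * Y) -
        (4 * β * t * s ^ (β - 1)) ^ 2 * Y) := by
  have hl' : (1 : ℝ) ≤ l := by exact_mod_cast hl
  have hinv : 1 / ((l : ℝ) + 2) ≤ 1 / 3 := by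
    apply one_div_le_one_div_of_le <;> linarith
  have hinv0 : 0 < 1 / ((l : ℝ) + 2) := by positivity
  have hβ0 : 0 < β := by linarith
  set P := s ^ (β - 1) with hP
  have hP0 : 0 < P := Real.rpow_pos_of_pos hs _
  have e1 : s ^ β = P * s := by
    rw [hP, Real.rpow_sub_one hs.ne']
    field_simp
  have e2 : s ^ (β - 1 - 1) = P / s := Real.rpow_sub_one hs.ne' _
  have e3 : P ^ l * (P ^ 2 * s) = 1 := by
    have : P ^ (l + 2) = s⁻¹ := by
      rw [hP, ← Real.rpow_mul_natCast hs.le, ← Real.rpow_neg_one]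
      congr 1
      rw [hβ]
      push_cast
      field_simp
      ring
    rw [← mul_assoc, ← pow_add, this, inv_mul_cancel₀ hs.ne']
  obtain ⟨z, rfl⟩ : ∃ z, Y = z * s := ⟨Y / s, by field_simp⟩
  have hz0 : 0 ≤ z := nonneg_of_mul_nonneg_left hY hs
  have hz1 : z ≤ 1 := by
    by_contra! h
    nlinarith
  have hbracket : 1 / 6 ≤ (1 + t ^ 2) * (1 - 2 * (1 - β) * z) - 4 * β * t ^ 2 * z := by
    have h1 : (1 - β) * z ≤ 1 / 3 :=
      (mul_le_of_le_one_right (by linarith) hz1).trans (by linarith)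
    have h2 : β * z ≤ 1 := mul_le_one₀ (by linarith) hz0 hz1
    have h3 : β * z * t ^ 2 ≤ 1 / 24 :=
      (mul_le_of_le_one_left (sq_nonneg t) h2).trans ht
    have h4 : 0 ≤ t ^ 2 * (1 - 2 * ((1 - β) * z)) := mul_nonneg (sq_nonneg t) (by linarith)
    nlinarith
  have hpow : 1 ≤ (1 + t ^ 2) ^ l := one_le_pow₀ (by nlinarith [sq_nonneg t])
  calc (2 * β) ^ l * (2 * β / 3)
      = (2 * β) ^ l * 1 * (4 * β * (1 / 6)) := by ring
    _ ≤ (2 * β) ^ l * (1 + t ^ 2) ^ l *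
        (4 * β * ((1 + t ^ 2) * (1 - 2 * (1 - β) * z) - 4 * β * t ^ 2 * z)) := by gcongr
    _ = (2 * β) ^ l * (1 + t ^ 2) ^ l * (P ^ l * (P ^ 2 * s)) *
        (4 * β * ((1 + t ^ 2) * (1 - 2 * (1 - β) * z) - 4 * β * t ^ 2 * z)) := by
      rw [e3, mul_one]
    _ = _ := by
      rw [e1, e2, mul_pow (2 * β * (1 + t ^ 2)), mul_pow (2 * β) (1 + t ^ 2)]
      have : P / s * (z * s) = P * z := by field_simp
      linear_combination (-(2 * β) ^ l * (1 + t ^ 2) ^ l * P ^ l * (2 * (P * s)) *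
        (4 * β * (β - 1) * (1 + t ^ 2))) * this

theorem hess_uSig_apply {n k : ℕ} (hn : 0 < n) (α : ℝ) {σ : ℝ} (hσ : 0 < σ)
    (x : EuclideanSpace ℝ (Fin n)) (i j : Fin n) :
    let T := Finset.univ.filter fun i : Fin n => 1 ≤ (i : ℕ) ∧ (i : ℕ) < k - 1
    let o : Fin n := ⟨0, hn⟩
    let s := σ + ∑ i ∈ T, (x i) ^ 2
    hess (uSig n k hn α σ) x i j =
      (if i = j then if j = o then 2 * s ^ (α / 2) else 0 else 0) +
      (if i = j then if j ∈ T then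
        2 * (α / 2) * (1 + (x o) ^ 2) * s ^ (α / 2 - 1) else 0 else 0) +
      4 * (α / 2) * x o * s ^ (α / 2 - 1) *
        ((if i = o then 1 else 0) * (if j ∈ T then x j else 0) +
          (if i ∈ T then x i else 0) * (if j = o then 1 else 0)) +
      4 * (α / 2) * (α / 2 - 1) * (1 + (x o) ^ 2) * s ^ (α / 2 - 1 - 1) *
        ((if i ∈ T then x i else 0) * (if j ∈ T then x j else 0)) :=
  hessian_one_add_sq_mul_rpow _ _ hσ _ x i j

theorem hess_uSig_eq_zero {n k : ℕ} (hn : 0 < n) (hk : 2 ≤ k) (α : ℝ) {σ : ℝ} (hσ : 0 < σ)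
    (x : EuclideanSpace ℝ (Fin n)) (i : Fin n) (hi : ¬ (i : ℕ) < k - 1) (j : Fin n) :
    hess (uSig n k hn α σ) x i j = 0 := by
  have hio : i ≠ ⟨0, hn⟩ := fun h => hi (by rw [h]; simp; omega)
  rw [hess_uSig_apply hn α hσ]
  by_cases hij : i = j
  · subst hij
    simp [hi, hio]
  · simp [hij, hi, hio]

theorem det_hess_uSig {n l : ℕ} (hn : 0 < n) (hln : l + 3 ≤ n) (α : ℝ) (hα : 0 < α)
    {σ : ℝ} (hσ : 0 < σ) (x : EuclideanSpace ℝ (Fin n)) :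
    let Y := ∑ i ∈ Finset.univ.filter
      (fun i : Fin n => 1 ≤ (i : ℕ) ∧ (i : ℕ) < l + 3 - 1), (x i) ^ 2
    let t := x ⟨0, hn⟩
    ((hess (uSig n (l + 3) hn α σ) x).toSquareBlockProp fun i => (i : ℕ) < l + 3 - 1).det =
      (2 * (α / 2) * (1 + t ^ 2) * (σ + Y) ^ (α / 2 - 1)) ^ l *
      (2 * (σ + Y) ^ (α / 2) * (2 * (α / 2) * (1 + t ^ 2) * (σ + Y) ^ (α / 2 - 1) +
        4 * (α / 2) * (α / 2 - 1) * (1 + t ^ 2) * (σ + Y) ^ (α / 2 - 1 - 1) * Y) -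
        (4 * (α / 2) * t * (σ + Y) ^ (α / 2 - 1)) ^ 2 * Y) := by
  intro Y t
  have hs : 0 < σ + Y := add_sum_sq_pos _ hσ x
  set T := Finset.univ.filter fun i : Fin n => 1 ≤ (i : ℕ) ∧ (i : ℕ) < l + 3 - 1 with hT
  let o : {i : Fin n // (i : ℕ) < l + 3 - 1} := ⟨⟨0, hn⟩, by simp⟩
  let y : {i : Fin n // (i : ℕ) < l + 3 - 1} → ℝ := fun i => if (i : Fin n) ∈ T then x i else 0
  have hy : y o = 0 := by simp [y, o, hT]
  have hsum : ∑ i, y i ^ 2 = Y := by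
    have h1 : ∑ i, y i ^ 2 = ∑ i : {i : Fin n // (i : ℕ) < l + 3 - 1},
        (fun i : Fin n => if i ∈ T then (x i) ^ 2 else 0) i :=
      Finset.sum_congr rfl fun i _ => by simp only [y]; split_ifs <;> simp
    rw [h1, ← Finset.sum_subtype (Finset.univ.filter fun i : Fin n => (i : ℕ) < l + 3 - 1)
      (by simp) fun i : Fin n => if i ∈ T then (x i) ^ 2 else 0, ← Finset.sum_filter]
    refine Finset.sum_congr ?_ fun _ _ => rfl
    ext i
    simp [hT]
  have hcard : Fintype.card {i : Fin n // (i : ℕ) < l + 3 - 1} = l + 2 := by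
    simp [Fintype.card_subtype, Fin.card_filter_val_lt]
    omega
  have ha : 2 * (σ + Y) ^ (α / 2) ≠ 0 := by positivity
  have hμ : 2 * (α / 2) * (1 + t ^ 2) * (σ + Y) ^ (α / 2 - 1) ≠ 0 := by positivity
  have key := det_diagonal_add_rank_two o y hy ha hμ (4 * (α / 2) * t * (σ + Y) ^ (α / 2 - 1))
    (4 * (α / 2) * (α / 2 - 1) * (1 + t ^ 2) * (σ + Y) ^ (α / 2 - 1 - 1)) hcard
  rw [hsum] at key
  rw [← key]
  congr 1
  ext i j
  rw [Matrix.toSquareBlockProp_def, Matrix.of_apply, Matrix.of_apply, hess_uSig_apply hn α hσ]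
  have ho : ∀ i : {i : Fin n // (i : ℕ) < l + 3 - 1}, (i : Fin n) = ⟨0, hn⟩ ↔ i = o :=
    fun i => by rw [Subtype.ext_iff]
  have hmem : (j : Fin n) ∈ T ↔ j ≠ o := by
    have hj := j.2
    rw [Ne, ← ho j, Fin.ext_iff]
    simp [hT]
    omega
  simp only [ho, ← Subtype.ext_iff]
  refine congrArg₂ (· + ·) (congrArg₂ (· + ·) ?_ rfl) rfl
  change (if i = j then if j = o then 2 * (σ + Y) ^ (α / 2) else 0 else 0) +
    (if i = j then if (j : Fin n) ∈ T then _ else 0 else 0) = _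
  by_cases hij : i = j
  · by_cases hjo : j = o
    · simp only [if_pos hij, if_pos hjo, if_neg (hmem.not.mpr (not_not.mpr hjo)), add_zero]
    · simp only [if_pos hij, if_neg hjo, if_pos (hmem.mpr hjo), zero_add]
      rfl
  · simp only [if_neg hij, add_zero]

/-- The computations behind the singular solution for the sum Hessian equation with `k ≥ 4`:
`σ_k(D²u^σ) = 0` everywhere, while `σ_{k-1}(D²u^σ)` has a uniform positive lower bound on a
small ball, uniformly in `σ ∈ (0,1]`. -/
theorem singular_solution_computations
    (n k : ℕ) (hn : 4 ≤ n) (hk : 4 ≤ k) (hkn : k ≤ n)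
    (α : ℝ) (hα : α = 2 - 2 / ((k : ℝ) - 1)) :
    (1 < α ∧ α < 2) ∧
    (∀ σ : ℝ, 0 < σ → ∀ x : EuclideanSpace ℝ (Fin n),
      sigmaMat k (hess (uSig n k (by omega) α σ) x) = 0) ∧
    (∃ r c : ℝ, 0 < r ∧ 0 < c ∧
      ∀ σ : ℝ, 0 < σ → σ ≤ 1 →
        ∀ x ∈ Metric.ball (0 : EuclideanSpace ℝ (Fin n)) r,
          c ≤ sigmaMat (k - 1) (hess (uSig n k (by omega) α σ) x)) := by
  have hk' : (4 : ℝ) ≤ k := by exact_mod_cast hk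
  have hd : 0 < 2 / ((k : ℝ) - 1) := div_pos two_pos (by linarith)
  have hd' : 2 / ((k : ℝ) - 1) < 1 := by
    rw [div_lt_one (by linarith)]
    linarith
  have hα0 : 0 < α := by linarith
  refine ⟨⟨by linarith, by linarith⟩, fun σ hσ x => ?_, ?_⟩
  · exact (sigmaMat_of_support (m := k - 1) (by omega) _
      (hess_uSig_eq_zero _ (by omega) α hσ x)).1 k (by omega) hkn
  · obtain ⟨l, rfl⟩ : ∃ l, k = l + 3 := ⟨k - 3, by omega⟩
    refine ⟨1 / 5, (2 * (α / 2)) ^ l * (2 * (α / 2) / 3), by norm_num, by positivity,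
      fun σ hσ _ x hx => ?_⟩
    rw [(sigmaMat_of_support (m := l + 3 - 1) (by omega) _
      (hess_uSig_eq_zero _ (by omega) α hσ x)).2, det_hess_uSig _ hkn α hα0 hσ x]
    have hY : 0 ≤ ∑ i ∈ Finset.univ.filter
        (fun i : Fin n => 1 ≤ (i : ℕ) ∧ (i : ℕ) < l + 3 - 1), (x i) ^ 2 :=
      Finset.sum_nonneg fun i _ => sq_nonneg _
    refine det_lower_bound (by omega) ?_ (by linarith) hY (by linarith) ?_
    · rw [hα]
      push_cast
      ring
    · have h1 := (PiLp.norm_apply_le x ⟨0, by omega⟩).trans_lt (mem_ball_zero_iff.mp hx)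
      rw [Real.norm_eq_abs] at h1
      rw [← sq_abs]
      nlinarith [abs_nonneg (x ⟨0, by omega⟩)]
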